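/- arXiv:1612.01733 — 2 statements merged into one kernel-verified Lean document; each statement's English description precedes it below -/
import Mathlib

section
/- Let k be a field of characteristic zero, V a finite-dimensional k-vector space, B₁ and B₂ linear endomorphisms of V, v ∈ V, w a linear functional on V, and c ∈ k with c ≠ 0. Assume B₁∘B₂ − B₂∘B₁ + (x ↦ w(x)·v) = c·id_V. Then for every linear subspace W of V which is invariant under both B₁ and B₂: (i) if v ∈ W then W = V; and (ii) if W is contained in the kernel of w then W = 0. -/
/-- In characteristic zero, a nonzero scalar is a commutator of endomorphisms only on the zero
space. -/
theorem subsingleton_of_commutator_eq_smul_id {k V : Type*} [Field k] [CharZero k]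
    [AddCommGroup V] [Module k V] [FiniteDimensional k V] (A B : V →ₗ[k] V) {c : k} (hc : c ≠ 0)
    (h : A ∘ₗ B - B ∘ₗ A = c • (LinearMap.id : V →ₗ[k] V)) : Subsingleton V := by
  have ht := congrArg (LinearMap.trace k V) h
  rw [map_sub, LinearMap.trace_comp_comm' A B, sub_self, map_smul, LinearMap.trace_id,
    smul_eq_mul, eq_comm, mul_eq_zero, or_iff_right hc, Nat.cast_eq_zero] at ht
  exact Module.finrank_zero_iff.mp ht

/-- Let `k` be a field of characteristic zero, `V` finite-dimensional,
`B₁ B₂ : V →ₗ[k] V`, `v ∈ V`, `w ∈ V*`, and `c ≠ 0` with `[B₁, B₂] + (x ↦ w(x)·v) = c·id`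
(the Calogero–Moser moment map equation). Then every subspace `W` invariant under `B₁` and
`B₂` satisfies: if `v ∈ W` then `W = V`, and if `W ⊆ ker w` then `W = 0`. -/
theorem stmt_9 (k : Type*) [Field k] [CharZero k]
    (V : Type*) [AddCommGroup V] [Module k V] [FiniteDimensional k V]
    (B₁ B₂ : V →ₗ[k] V) (v : V) (w : V →ₗ[k] k) (c : k) (hc : c ≠ 0)
    (h : B₁ ∘ₗ B₂ - B₂ ∘ₗ B₁ + LinearMap.smulRight w v = c • (LinearMap.id : V →ₗ[k] V))
    (W : Submodule k V) (h₁ : ∀ x ∈ W, B₁ x ∈ W) (h₂ : ∀ x ∈ W, B₂ x ∈ W) :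
    (v ∈ W → W = ⊤) ∧ (W ≤ LinearMap.ker w → W = ⊥) := by
  have hx (x : V) : B₁ (B₂ x) - B₂ (B₁ x) + w x • v = c • x := by
    simpa using LinearMap.congr_fun h x
  refine ⟨fun hv => ?_, fun hw => ?_⟩
  · rw [← Submodule.Quotient.subsingleton_iff]
    refine subsingleton_of_commutator_eq_smul_id (W.mapQ W B₁ h₁) (W.mapQ W B₂ h₂) hc ?_
    ext x
    have hq := congrArg W.mkQ (hx x)
    have hv0 : W.mkQ v = 0 := (Submodule.Quotient.mk_eq_zero W).mpr hv
    rw [map_add, map_smul, hv0, smul_zero, add_zero] at hq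
    simpa using hq
  · rw [← Submodule.subsingleton_iff_eq_bot]
    refine subsingleton_of_commutator_eq_smul_id (B₁.restrict h₁) (B₂.restrict h₂) hc ?_
    ext x
    have hw0 : w x = 0 := hw x.2
    simpa [hw0] using hx x
end

section
/- Let k be a finite field and A a nonzero finite-dimensional associative unital k-algebra. Then the following are equivalent: (a) for every finite field extension K of k, the K-algebra K ⊗_k A contains no idempotent elements other than 0 and 1; (b) for every a ∈ A there exists a scalar c ∈ k such that a − c·1 is nilpotent. -/
open scoped TensorProduct

/-- Every element of a finite monoid has a positive power which is idempotent. -/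
theorem exists_pos_isIdempotentElem_pow {M : Type*} [Monoid M] [Finite M] (x : M) :
    ∃ n, 0 < n ∧ IsIdempotentElem (x ^ n) := by
  obtain ⟨i, j, hij, h⟩ := Set.finite_univ.exists_lt_map_eq_of_forall_mem
    (f := fun n : ℕ ↦ x ^ n) fun _ ↦ Set.mem_univ _
  obtain ⟨d, rfl⟩ := Nat.exists_eq_add_of_lt hij
  have step (m : ℕ) (hm : i ≤ m) (t : ℕ) : x ^ (m + (d + 1) * t) = x ^ m := by
    induction t with
    | zero => simp
    | succ t ih =>
      obtain ⟨s, rfl⟩ := Nat.exists_eq_add_of_le hm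
      calc x ^ (i + s + (d + 1) * (t + 1)) = x ^ (i + d + 1) * x ^ (s + (d + 1) * t) := by
            rw [← pow_add]; congr 1; ring
        _ = x ^ (i + s + (d + 1) * t) := by
            rw [← show x ^ i = x ^ (i + d + 1) from h, ← pow_add]; congr 1; ring
        _ = x ^ (i + s) := ih
  refine ⟨(d + 1) * (i + 1), by positivity, ?_⟩
  rw [IsIdempotentElem, ← pow_add]
  exact step _ (by nlinarith) _

/-- In a finite ring with only trivial idempotents, every nonunit is nilpotent. -/
theorem isNilpotent_of_not_isUnit_of_finite {R : Type*} [Ring R] [Finite R]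
    (h : ∀ e : R, e * e = e → e = 0 ∨ e = 1) {x : R} (hx : ¬ IsUnit x) : IsNilpotent x := by
  obtain ⟨n, hn, he⟩ := exists_pos_isIdempotentElem_pow x
  exact (h _ he).elim (fun h0 ↦ ⟨n, h0⟩)
    fun h1 ↦ (hx (IsUnit.of_pow_eq_one h1 hn.ne')).elim

namespace Submodule

variable {k K A : Type*} [CommRing k] [CommRing K] [Algebra k K] [Ring A] [Algebra k A]

theorem baseChange_induction {I : Submodule k A} {p : K ⊗[k] A → Prop}
    (tmul : ∀ (c : K), ∀ a ∈ I, p (c ⊗ₜ a)) (add : ∀ x y, p x → p y → p (x + y))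
    {x : K ⊗[k] A} (hx : x ∈ I.baseChange K) : p x := by
  obtain ⟨y, rfl⟩ := hx
  induction y with
  | zero => simpa using tmul 0 0 I.zero_mem
  | tmul c a => exact tmul c a a.2
  | add y z hy hz => rw [map_add]; exact add _ _ hy hz

theorem mul_mem_baseChange {I J L : Submodule k A} (h : ∀ a ∈ I, ∀ b ∈ J, a * b ∈ L)
    {x y : K ⊗[k] A} (hx : x ∈ I.baseChange K) (hy : y ∈ J.baseChange K) :
    x * y ∈ L.baseChange K := by
  refine baseChange_induction (p := fun x ↦ x * y ∈ L.baseChange K) (fun c a ha ↦ ?_)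
    (fun u v hu hv ↦ by rw [add_mul]; exact add_mem hu hv) hx
  refine baseChange_induction (p := fun y ↦ c ⊗ₜ a * y ∈ L.baseChange K) (fun d b hb ↦ ?_)
    (fun u v hu hv ↦ by rw [mul_add]; exact add_mem hu hv) hy
  rw [Algebra.TensorProduct.tmul_mul_tmul]
  exact tmul_mem_baseChange_of_mem _ (h a ha b hb)

/-- The base change of a nilpotent left ideal contains no nonzero idempotent. -/
theorem eq_zero_of_mem_baseChange_of_isNilpotent {I : Ideal A} (hI : IsNilpotent I)
    {e : K ⊗[k] A} (he : e * e = e) (hmem : e ∈ (I.restrictScalars k).baseChange K) : e = 0 := by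
  obtain ⟨n, hn⟩ := hI
  have key (m : ℕ) : e ∈ ((I ^ (m + 1)).restrictScalars k).baseChange K := by
    induction m with
    | zero => rwa [zero_add, Submodule.pow_one]
    | succ m ih =>
      rw [← he]
      refine mul_mem_baseChange (fun a ha b hb ↦ ?_) ih hmem
      rw [restrictScalars_mem, Submodule.pow_succ]
      exact Ideal.mul_mem_mul ha hb
  have h := key n
  rw [Submodule.pow_succ, hn, zero_eq_bot, bot_mul, restrictScalars_bot, baseChange_bot] at h
  exact h

end Submodule

section

variable {k A : Type*} [Field k] [Ring A] [Algebra k A]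

theorem isUnit_of_isNilpotent_sub_algebraMap {a : A} {c : k} (hc : c ≠ 0)
    (h : IsNilpotent (a - algebraMap k A c)) : IsUnit a := by
  have hu : IsUnit (algebraMap k A c) := (IsUnit.mk0 c hc).map _
  simpa using h.isUnit_add_right_of_commute hu (Algebra.commutes c _).symm

/-- If every element is a scalar plus a nilpotent, then nilpotents lie in the radical. -/
theorem mem_jacobson_of_isNilpotent [Nontrivial A]
    (h : ∀ a : A, ∃ c : k, IsNilpotent (a - algebraMap k A c)) {x : A} (hx : IsNilpotent x) :
    x ∈ Ring.jacobson A := by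
  rw [← Ideal.jacobson_bot, Ideal.mem_jacobson_iff]
  intro y
  obtain ⟨c, hc⟩ := h (y * x)
  have hc0 : c = 0 := by
    by_contra hne
    obtain ⟨u, hu⟩ := isUnit_of_isNilpotent_sub_algebraMap hne hc
    have hleft : (↑u⁻¹ * y) * x = 1 := by rw [mul_assoc, ← hu, Units.inv_mul]
    obtain ⟨n, hn⟩ := hx
    have := pow_mul_pow_eq_one n hleft
    simp [hn] at this
  obtain ⟨u, hu⟩ := (show IsNilpotent (y * x) by simpa [hc0] using hc).isUnit_add_one
  refine ⟨↑u⁻¹, ?_⟩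
  rw [Ideal.mem_bot, mul_assoc, ← mul_add_one, ← hu, Units.inv_mul, sub_self]

theorem eq_zero_or_one_of_forall_isNilpotent_sub [Nontrivial A] [FiniteDimensional k A]
    (h : ∀ a : A, ∃ c : k, IsNilpotent (a - algebraMap k A c))
    {K : Type*} [Field K] [Algebra k K] {e : K ⊗[k] A} (he : e * e = e) : e = 0 ∨ e = 1 := by
  have : IsArtinianRing A := IsArtinianRing.of_finite k A
  have hJ : IsNilpotent (Ring.jacobson A) := IsSemiprimaryRing.isNilpotent
  set P := ((Ring.jacobson A).restrictScalars k).baseChange K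
  have hmul {x y : K ⊗[k] A} (hx : x ∈ P) (hy : y ∈ P) : x * y ∈ P :=
    Submodule.mul_mem_baseChange (fun a _ b hb ↦ (Ring.jacobson A).mul_mem_left a hb) hx hy
  have decomp (x : K ⊗[k] A) : ∃ c : K, x - algebraMap K _ c ∈ P := by
    induction x with
    | zero => exact ⟨0, by simp⟩
    | tmul c a =>
      obtain ⟨d, hd⟩ := h a
      refine ⟨d • c, ?_⟩
      have : c ⊗ₜ[k] a - algebraMap K (K ⊗[k] A) (d • c) =
          c ⊗ₜ[k] (a - algebraMap k A d) := by
        rw [TensorProduct.tmul_sub, Algebra.TensorProduct.algebraMap_apply,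
          Algebra.algebraMap_eq_smul_one d, TensorProduct.tmul_smul, TensorProduct.smul_tmul']
        rfl
      rw [this]
      exact Submodule.tmul_mem_baseChange_of_mem _ (mem_jacobson_of_isNilpotent h hd)
    | add x y hx hy =>
      obtain ⟨c, hc⟩ := hx
      obtain ⟨d, hd⟩ := hy
      exact ⟨c + d, by rw [map_add, add_sub_add_comm]; exact add_mem hc hd⟩
  have idem {f : K ⊗[k] A} (hf : f * f = f) (hmem : f ∈ P) : f = 0 :=
    Submodule.eq_zero_of_mem_baseChange_of_isNilpotent hJ hf hmem
  obtain ⟨c, hc⟩ := decomp e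
  have hscalar : algebraMap K (K ⊗[k] A) (c - c * c) ∈ P := by
    set p := e - algebraMap K (K ⊗[k] A) c with hp
    have hep : e = c • 1 + p := by rw [hp, Algebra.algebraMap_eq_smul_one]; abel
    have : algebraMap K (K ⊗[k] A) (c - c * c) = p * p + c • p + c • p - p := by
      have h2 : (c • 1 + p) * (c • 1 + p) = c • 1 + p := hep ▸ he
      simp only [add_mul, mul_add, smul_add, smul_mul_assoc, mul_smul_comm, one_mul, mul_one] at h2
      rw [Algebra.algebraMap_eq_smul_one, sub_smul, mul_smul, eq_sub_iff_add_eq,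
        sub_add_eq_add_sub, ← h2]
      abel
    rw [this]
    exact sub_mem (add_mem (add_mem (hmul hc hc) (P.smul_mem c hc)) (P.smul_mem c hc)) hc
  have hcc : c - c * c = 0 := by
    by_contra hne
    have h1 : (1 : K ⊗[k] A) ∈ P := by
      have := P.smul_mem (c - c * c)⁻¹ hscalar
      rwa [Algebra.algebraMap_eq_smul_one, smul_smul, inv_mul_cancel₀ hne, one_smul] at this
    exact one_ne_zero (idem (one_mul 1) h1)
  have : c * (1 - c) = 0 := by rw [← hcc]; ring
  rcases mul_eq_zero.mp this with h0 | h1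
  · left
    exact idem he (by simpa [h0] using hc)
  · right
    obtain rfl : c = 1 := (sub_eq_zero.mp h1).symm
    have h1e : 1 - e ∈ P := by
      rw [← neg_sub]; exact P.neg_mem (by rwa [map_one] at hc)
    exact (sub_eq_zero.mp (idem (IsIdempotentElem.one_sub he) h1e)).symm

/-- An element whose image in a base change is scalar is itself scalar. -/
theorem exists_algebraMap_eq_of_one_tmul_eq {K : Type*} [Field K] [Algebra k K]
    {b : A} {c : K} (h : (1 : K) ⊗ₜ[k] b = c ⊗ₜ[k] (1 : A)) : ∃ d : k, algebraMap k A d = b := by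
  by_contra! hb
  have hb' : b ∉ Submodule.span k {(1 : A)} := by
    rw [Submodule.mem_span_singleton]
    rintro ⟨d, hd⟩
    exact hb d (by rw [Algebra.algebraMap_eq_smul_one, hd])
  obtain ⟨f, hfb, hf⟩ := Submodule.exists_dual_map_eq_bot_of_notMem hb' inferInstance
  have hf1 : f 1 = 0 := by
    have : f 1 ∈ (Submodule.span k {(1 : A)}).map f :=
      Submodule.mem_map_of_mem (Submodule.mem_span_singleton_self 1)
    rwa [hf] at this
  have := congrArg (fun x ↦ TensorProduct.rid k K (f.lTensor K x)) h
  simp [hf1, hfb] at this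

/-- If a finite base change along a field splitting the minimal polynomial of `a` has only trivial
idempotents, then `a` is a scalar plus a nilpotent. -/
theorem exists_isNilpotent_sub_of_splits [Finite k] [Nontrivial A] [FiniteDimensional k A]
    {K : Type*} [Field K] [Algebra k K] [FiniteDimensional k K]
    (h : ∀ e : K ⊗[k] A, e * e = e → e = 0 ∨ e = 1) (a : A)
    (ha : ((minpoly k a).map (algebraMap k K)).Splits) :
    ∃ c : k, IsNilpotent (a - algebraMap k A c) := by
  have : Finite (K ⊗[k] A) := Module.finite_of_finite k
  let i : A →ₐ[k] K ⊗[k] A := Algebra.TensorProduct.includeRight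
  have hmonic := (minpoly.monic (Algebra.IsIntegral.isIntegral (R := k) a)).map (algebraMap k K)
  have hzero : Polynomial.aeval (i a) ((minpoly k a).map (algebraMap k K)) = 0 := by
    rw [Polynomial.aeval_map_algebraMap, Polynomial.aeval_algHom_apply, minpoly.aeval, map_zero]
  rw [ha.eq_prod_roots_of_monic hmonic] at hzero
  obtain ⟨r, hr, -⟩ := spectrum.exists_mem_of_not_isUnit_aeval_prod
    (by rw [hzero]; exact not_isUnit_zero)
  have hnil : IsNilpotent (i a - algebraMap K (K ⊗[k] A) r) := by
    refine isNilpotent_of_not_isUnit_of_finite h fun hu ↦ spectrum.mem_iff.mp hr ?_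
    rw [← neg_sub]
    exact hu.neg
  have := Fintype.ofFinite k
  let p := ringChar k
  obtain ⟨n, hp, hn⟩ := FiniteField.card k p
  have : ExpChar k p := .prime hp
  have : ExpChar A p := expChar_of_injective_algebraMap (algebraMap k A).injective p
  have : ExpChar (K ⊗[k] A) p :=
    expChar_of_injective_algebraMap (algebraMap k (K ⊗[k] A)).injective p
  obtain ⟨m, hm⟩ := hnil
  have hle : m ≤ p ^ (n * m : ℕ) :=
    ((Nat.le_mul_of_pos_left m n.pos).trans (Nat.lt_pow_self hp.one_lt).le)
  have hpow := pow_eq_zero_of_le hle hm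
  rw [sub_pow_expChar_pow_of_commute _ _ (Algebra.commutes r _).symm, sub_eq_zero, ← map_pow,
    ← map_pow] at hpow
  obtain ⟨c, hc⟩ := exists_algebraMap_eq_of_one_tmul_eq (k := k) hpow
  refine ⟨c, p ^ (n * m : ℕ), ?_⟩
  rw [sub_pow_expChar_pow_of_commute _ _ (Algebra.commutes c _).symm, ← map_pow, ← hc,
    sub_eq_zero, pow_mul, ← hn, FiniteField.pow_card_pow]

end

universe u v

/-- A polynomial over a finite field splits in a finite extension living in any given universe. -/
theorem exists_finiteDimensional_splits {k : Type u} [Field k] [Finite k] (f : Polynomial k) :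
    ∃ (K : Type v) (_ : Field K) (_ : Algebra k K),
      FiniteDimensional k K ∧ (f.map (algebraMap k K)).Splits := by
  have : Finite f.SplittingField := Module.finite_of_finite k
  let φ : f.SplittingField ≃ₐ[k] Shrink.{v} f.SplittingField := (Shrink.algEquiv k _).symm
  refine ⟨Shrink.{v} f.SplittingField, inferInstance, inferInstance,
    φ.toLinearEquiv.finiteDimensional, ?_⟩
  have hs := (Polynomial.SplittingField.splits f).map (φ.toAlgHom : f.SplittingField →+* Shrink.{v} f.SplittingField)
  rwa [Polynomial.map_map, φ.toAlgHom.comp_algebraMap] at hs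

/-- For a nonzero finite-dimensional algebra `A` over a finite field `k`,
the following are equivalent: (a) for every finite field extension `K/k` the algebra
`K ⊗_k A` has no idempotents other than `0` and `1`; (b) every element of `A` is a scalar
plus a nilpotent. -/
theorem stmt_12 (k : Type*) [Field k] [Finite k]
    (A : Type*) [Ring A] [Algebra k A] [Nontrivial A] [FiniteDimensional k A] :
    (∀ (K : Type*) [Field K] [Algebra k K] [FiniteDimensional k K],
        ∀ e : K ⊗[k] A, e * e = e → e = 0 ∨ e = 1) ↔
      ∀ a : A, ∃ c : k, IsNilpotent (a - algebraMap k A c) := by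
  refine ⟨fun h a ↦ ?_, fun h K _ _ _ e he ↦ eq_zero_or_one_of_forall_isNilpotent_sub h he⟩
  obtain ⟨K, _, _, _, hK⟩ := exists_finiteDimensional_splits (minpoly k a)
  exact exists_isNilpotent_sub_of_splits (h K) a hK
end
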